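/- Suppose T = {1}, 1 ≤ |Q| ≤ 2, a_q ≤ b_1 and b_1·r + c < a_q for all q ∈ Q, and Σ_{q∈Q} a_q − a_{q'} ≤ b_1(r + 1) + c < Σ_{q∈Q} a_q for every q' ∈ Q. Let (x̄, ȳ) ∈ X_LP. Then the inequality Σ_{q∈Q} x_q ≤ y_1 − r is facet-defining for P, and (e, 1, −r) is an optimal solution of the separation problem for (x̄, ȳ): for every (α, β_1, γ) with β_1 = 1 such that α^⊤x ≤ β_1 y_1 + γ holds for all (x, y) ∈ X, one has x̄^⊤α − ȳ_1 β_1 − γ ≤ Σ_{q∈Q} x̄_q − ȳ_1 + r. -/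

import Mathlib

open scoped BigOperators

/-- The unsplittable flow arc-set `X`. -/
def ufX {Q T : Type*} [Fintype Q] [Fintype T] (a : Q → ℝ) (b : T → ℝ) (c : ℝ) :
    Set ((Q → ℝ) × (T → ℝ)) :=
  {p | (∀ q, p.1 q = 0 ∨ p.1 q = 1) ∧ (∀ t, ∃ n : ℕ, p.2 t = n) ∧
    ∑ q, a q * p.1 q ≤ ∑ t, b t * p.2 t + c}

/-- The unsplittable flow arc-set polyhedron `P = conv(X)`. -/
noncomputable def ufP {Q T : Type*} [Fintype Q] [Fintype T]
    (a : Q → ℝ) (b : T → ℝ) (c : ℝ) : Set ((Q → ℝ) × (T → ℝ)) :=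
  convexHull ℝ (ufX a b c)

/-- The inequality `α᳐x ≤ β᳐y + γ` is valid for `P` (equivalently, holds on `X`). -/
def ufValid {Q T : Type*} [Fintype Q] [Fintype T] (a : Q → ℝ) (b : T → ℝ) (c : ℝ)
    (α : Q → ℝ) (β : T → ℝ) (γ : ℝ) : Prop :=
  ∀ p ∈ ufX a b c, ∑ q, α q * p.1 q ≤ ∑ t, β t * p.2 t + γ

/-- The inequality `α᳐x ≤ β᳐y + γ` is facet-defining for `P`: it is valid and the
face `F = {(x,y) ∈ P : α᳐x = β᳐y + γ}` contains `|Q| + |T|` affinely independent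
points. -/
noncomputable def ufFacet {Q T : Type*} [Fintype Q] [Fintype T]
    (a : Q → ℝ) (b : T → ℝ) (c : ℝ) (α : Q → ℝ) (β : T → ℝ) (γ : ℝ) : Prop :=
  ufValid a b c α β γ ∧
  ∃ pts : Fin (Fintype.card Q + Fintype.card T) → (Q → ℝ) × (T → ℝ),
    (∀ i, pts i ∈ ufP a b c ∧
      ∑ q, α q * (pts i).1 q = ∑ t, β t * (pts i).2 t + γ) ∧
    AffineIndependent ℝ pts

/-- The linear relaxation `X_LP` of `X`. -/
def ufXLP {Q T : Type*} [Fintype Q] [Fintype T] (a : Q → ℝ) (b : T → ℝ) (c : ℝ) :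
    Set ((Q → ℝ) × (T → ℝ)) :=
  {p | (∀ q, 0 ≤ p.1 q ∧ p.1 q ≤ 1) ∧ (∀ t, 0 ≤ p.2 t) ∧
    ∑ q, a q * p.1 q ≤ ∑ t, b t * p.2 t + c}

/-- The vertices `0` and `e_q` of the unit simplex stay affinely independent when each is
extended by a further coordinate vector. -/
lemma affineIndependent_option_single {Q E : Type*} [Fintype Q] [DecidableEq Q]
    [AddCommGroup E] [Module ℝ E] (u : E) (v : Q → E) :
    AffineIndependent ℝ
      (fun o : Option Q => o.elim ((0 : Q → ℝ), u) fun q => (Pi.single q (1 : ℝ), v q)) := by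
  rw [affineIndependent_iff_of_fintype]
  intro w hw hp
  rw [Finset.univ.weightedVSub_eq_linear_combination hw, Fintype.sum_option] at hp
  have hsome : ∀ q, w (some q) = 0 := by
    intro q
    have h := congrFun (congrArg Prod.fst hp) q
    simpa [Prod.fst_sum, Finset.sum_apply, Pi.single_apply] using h
  rintro (_ | q)
  · simpa [Fintype.sum_option, hsome] using hw
  · exact hsome q

/-- A linear form bounded on the vertices of the unit square is bounded on the square. -/
lemma add_mul_le_of_mem_unit_square {p q g x y : ℝ} (hx0 : 0 ≤ x) (hx1 : x ≤ 1)
    (hy0 : 0 ≤ y) (hy1 : y ≤ 1) (hg : 0 ≤ g) (hp : p ≤ g) (hq : q ≤ g) (hpq : p + q ≤ g) :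
    p * x + q * y ≤ g := by
  nlinarith [mul_nonneg (mul_nonneg (sub_nonneg.2 hx1) (sub_nonneg.2 hy1)) hg,
    mul_nonneg (mul_nonneg hx0 (sub_nonneg.2 hy1)) (sub_nonneg.2 hp),
    mul_nonneg (mul_nonneg (sub_nonneg.2 hx1) hy0) (sub_nonneg.2 hq),
    mul_nonneg (mul_nonneg hx0 hy0) (sub_nonneg.2 hpq)]

/-- Proposition 6(a), single facility, condition (6), `|Q| ≤ 2`:
the inequality `Σ_q x_q ≤ y_1 − r` is facet-defining for `P` and `(e, 1, −r)`
solves the separation problem for `(x̄, ȳ)`. -/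
theorem single_facility_case2_small {Q T : Type*} [Fintype Q] [Fintype T]
    [DecidableEq Q] [DecidableEq T]
    (a : Q → ℝ) (b : T → ℝ) (c : ℝ) (t1 : T) (hT : ∀ t : T, t = t1)
    (ha : ∀ q, 0 < a q) (hb : ∀ t, 0 < b t) (hb1 : ∀ t, b t1 ≤ b t)
    (hc : 0 < ∑ q, a q - c)
    (hQ1 : 1 ≤ Fintype.card Q) (hQ2 : Fintype.card Q ≤ 2)
    (r : ℝ) (hr : r = max ((⌈-c / b t1⌉ : ℤ) : ℝ) 0)
    (h1 : ∀ q, a q ≤ b t1) (h2 : ∀ q, b t1 * r + c < a q)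
    (h3 : ∀ q' : Q, ∑ q, a q - a q' ≤ b t1 * (r + 1) + c ∧
      b t1 * (r + 1) + c < ∑ q, a q)
    (xb : Q → ℝ) (yb : T → ℝ) (hxy : (xb, yb) ∈ ufXLP a b c) :
    ufFacet a b c (fun _ => (1 : ℝ)) (Pi.single t1 (1 : ℝ)) (-r) ∧
    ∀ (α : Q → ℝ) (β : T → ℝ) (γ : ℝ), β t1 = 1 →
      ufValid a b c α β γ →
      ∑ q, xb q * α q - ∑ t, yb t * β t - γ ≤ ∑ q, xb q - yb t1 + r := by
  have hbt := hb t1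
  obtain ⟨k, hk⟩ : ∃ k : ℕ, r = k := by
    refine ⟨⌈-c / b t1⌉.toNat, ?_⟩
    have h := congrArg (Int.cast : ℤ → ℝ) (Int.toNat_eq_max ⌈-c / b t1⌉)
    push_cast at h
    rw [hr, h]
  have hrc : 0 ≤ b t1 * r + c := by
    have h : -c / b t1 ≤ r := (Int.le_ceil _).trans (hr ▸ le_max_left _ _)
    rw [div_le_iff₀ hbt] at h
    linarith
  have hmin : ∀ n : ℕ, 0 ≤ b t1 * n + c → r ≤ n := by
    intro n hn
    rw [hr]
    refine max_le ?_ n.cast_nonneg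
    have h : -c / b t1 ≤ ((n : ℤ) : ℝ) := by
      rw [div_le_iff₀ hbt]
      push_cast
      linarith
    exact_mod_cast Int.ceil_le.2 h
  have hcardT : Fintype.card T = 1 := Fintype.card_eq_one_iff.2 ⟨t1, hT⟩
  obtain ⟨u, v, huv, huniv⟩ : ∃ u v : Q, u ≠ v ∧ (Finset.univ : Finset Q) = {u, v} := by
    refine Finset.card_eq_two.1 ?_
    rw [Finset.card_univ]
    by_contra hne
    obtain ⟨u, hu⟩ := Finset.card_eq_one.1
      (show (Finset.univ : Finset Q).card = 1 by rw [Finset.card_univ]; omega)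
    have h := (h3 u).2
    rw [hu, Finset.sum_singleton] at h
    linarith [h1 u]
  have hsum : ∀ f : Q → ℝ, ∑ q, f q = f u + f v := fun f => by
    rw [huniv, Finset.sum_pair huv]
  have hsumT : ∀ f : T → ℝ, ∑ t, f t = f t1 := fun f => by
    exact Fintype.sum_eq_single t1 fun t ht => absurd (hT t) ht
  have hau := ha u
  have hav := ha v
  have h2u := h2 u
  have h2v := h2 v
  have h3u := h3 u
  have h3v := h3 v
  rw [hsum] at h3u h3v
  have hzero : ((0 : Q → ℝ), fun _ : T => r) ∈ ufX a b c :=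
    ⟨fun _ => Or.inl rfl, fun _ => ⟨k, hk⟩, by simpa [hsumT] using hrc⟩
  have hsingle : ∀ q, ((Pi.single q 1 : Q → ℝ), fun _ : T => r + 1) ∈ ufX a b c := by
    refine fun q => ⟨fun q' => ?_, fun _ => ⟨k + 1, by simp [hk]⟩, ?_⟩
    · rcases eq_or_ne q' q with rfl | h
      · simp
      · simp [h]
    · simp only [hsumT, Pi.single_apply, mul_ite, mul_one, mul_zero, Finset.sum_ite_eq',
        Finset.mem_univ, if_true]
      linarith [h1 q]
  have hone : ((1 : Q → ℝ), fun _ : T => r + 2) ∈ ufX a b c := by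
    refine ⟨fun _ => Or.inr rfl, fun _ => ⟨k + 2, by simp [hk]⟩, ?_⟩
    simp only [hsumT, hsum, Pi.one_apply]
    linarith [h1 u, h1 v]
  refine ⟨⟨?_, ?_⟩, ?_⟩
  · rintro ⟨x, y⟩ ⟨hx, hy, hle⟩
    obtain ⟨n, hn⟩ := hy t1
    simp only [hsum, hsumT, Pi.single_eq_same, one_mul] at hx hn hle ⊢
    rw [hn] at hle ⊢
    have hlower : r ≤ n := hmin n (by
      rcases hx u with h | h <;> rcases hx v with h' | h' <;> rw [h, h'] at hle <;> linarith)
    rw [hk] at hlower h2u h2v h3u h3v ⊢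
    have hcases : n = k ∨ n = k + 1 ∨ k + 2 ≤ n := by
      have : k ≤ n := by exact_mod_cast hlower
      omega
    rcases hcases with rfl | rfl | h
    · rcases hx u with h | h <;> rcases hx v with h' | h' <;> rw [h, h'] at hle ⊢ <;> linarith
    · push_cast at hle ⊢
      rcases hx u with h | h <;> rcases hx v with h' | h' <;> rw [h, h'] at hle ⊢ <;> linarith
    · have : (k : ℝ) + 2 ≤ n := by exact_mod_cast h
      rcases hx u with h | h <;> rcases hx v with h' | h' <;> rw [h, h'] <;> linarith
  · have e : Fin (Fintype.card Q + Fintype.card T) ≃ Option Q :=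
      Fintype.equivOfCardEq (by simp [hcardT])
    refine ⟨_, ?_, (affineIndependent_equiv e).2
      (affineIndependent_option_single (fun _ : T => r) fun _ _ => r + 1)⟩
    intro i
    rw [Function.comp_apply]
    rcases e i with _ | q
    · refine ⟨subset_convexHull ℝ _ hzero, ?_⟩
      simp [hsumT]
    · refine ⟨subset_convexHull ℝ _ (hsingle q), ?_⟩
      simp [hsumT]
  · intro α β γ hβ hval
    have hv0 := hval _ hzero
    have hvu := hval _ (hsingle u)
    have hvv := hval _ (hsingle v)
    have hv1 := hval _ hone
    simp only [hsumT, hsum, hβ, Pi.zero_apply, Pi.one_apply, Pi.single_eq_same,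
      Pi.single_eq_of_ne huv, Pi.single_eq_of_ne huv.symm] at hv0 hvu hvv hv1
    obtain ⟨hu0, hu1⟩ := hxy.1 u
    obtain ⟨hw0, hw1⟩ := hxy.1 v
    have h := add_mul_le_of_mem_unit_square (p := α u - 1) (q := α v - 1) (g := γ + r)
      hu0 hu1 hw0 hw1 (by linarith) (by linarith) (by linarith) (by linarith)
    simp only [hsumT, hsum, hβ]
    dsimp only at h
    linarith
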